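/- Let f_{W,λ} be a binarized deep neural network with K layers, arbitrary real weight matrices W^k ∈ ℝ^{d_k×d_{k-1}} and arbitrary real thresholds λ_k ∈ ℝ. Then there exist weight matrices W̃^k with all entries in [−1,1] and thresholds λ̃_k ∈ [−1,1] such that f_{W̃,λ̃}(x) = f_{W,λ}(x) for every x ∈ ℝⁿ. -/

import Mathlib

/-- The binarized deep neural network: `bdnn d W lam x k` is the output of the `k`-th layer
on input `x`, where layer `k+1` applies weight matrix `W k` and threshold `lam k`
followed by the binary activation `α ↦ if α ≥ λ then 1 else 0`. -/
noncomputable def bdnn (d : ℕ → ℕ) (W : ∀ k, Matrix (Fin (d (k + 1))) (Fin (d k)) ℝ)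
    (lam : ℕ → ℝ) (x : Fin (d 0) → ℝ) : (k : ℕ) → Fin (d k) → ℝ
  | 0 => x
  | k + 1 => fun j => if lam k ≤ (W k).mulVec (bdnn d W lam x k) j then 1 else 0

/-- Scaling the weights and the threshold of each layer by a positive constant does not change
the network. -/
theorem bdnn_smul (d : ℕ → ℕ) (W : ∀ k, Matrix (Fin (d (k + 1))) (Fin (d k)) ℝ) (lam : ℕ → ℝ)
    (c : ℕ → ℝ) (hc : ∀ k, 0 < c k) (x : Fin (d 0) → ℝ) (K : ℕ) :
    bdnn d (fun k => c k • W k) (fun k => c k * lam k) x K = bdnn d W lam x K := by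
  induction K with
  | zero => rfl
  | succ k ih =>
    funext j
    simp only [bdnn, ih, Matrix.smul_mulVec, Pi.smul_apply, smul_eq_mul,
      mul_le_mul_iff_right₀ (hc k)]

theorem exists_pos_scaling_mem_Icc {m n : ℕ} (A : Matrix (Fin m) (Fin n) ℝ) (t : ℝ) :
    ∃ c : ℝ, 0 < c ∧ (∀ i j, c * A i j ∈ Set.Icc (-1 : ℝ) 1) ∧ c * t ∈ Set.Icc (-1 : ℝ) 1 := by
  have hS : 0 ≤ ∑ p : Fin m × Fin n, |A p.1 p.2| := Finset.sum_nonneg fun _ _ => abs_nonneg _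
  have ht := abs_nonneg t
  have hpos : 0 < 1 + |t| + ∑ p : Fin m × Fin n, |A p.1 p.2| := by linarith
  have key : ∀ a : ℝ, |a| ≤ 1 + |t| + ∑ p : Fin m × Fin n, |A p.1 p.2| →
      (1 + |t| + ∑ p : Fin m × Fin n, |A p.1 p.2|)⁻¹ * a ∈ Set.Icc (-1 : ℝ) 1 := by
    intro a ha
    rw [Set.mem_Icc, ← abs_le, abs_mul, abs_of_pos (inv_pos.2 hpos)]
    exact inv_mul_le_one_of_le₀ ha hpos.le
  refine ⟨_, inv_pos.2 hpos, fun i j => key _ ?_, key _ (by linarith)⟩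
  have h := Finset.single_le_sum (f := fun p : Fin m × Fin n => |A p.1 p.2|)
    (fun _ _ => abs_nonneg _) (Finset.mem_univ (i, j))
  dsimp only at h
  linarith

/-- For any BDNN with arbitrary real weights and thresholds there are weights with entries
in `[-1,1]` and thresholds in `[-1,1]` computing the same function. -/
theorem stmt1 (K : ℕ) (d : ℕ → ℕ)
    (W : ∀ k, Matrix (Fin (d (k + 1))) (Fin (d k)) ℝ) (lam : ℕ → ℝ) :
    ∃ (W' : ∀ k, Matrix (Fin (d (k + 1))) (Fin (d k)) ℝ) (lam' : ℕ → ℝ),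
      (∀ k j l, W' k j l ∈ Set.Icc (-1 : ℝ) 1) ∧
      (∀ k, lam' k ∈ Set.Icc (-1 : ℝ) 1) ∧
      ∀ x : Fin (d 0) → ℝ, bdnn d W' lam' x K = bdnn d W lam x K := by
  choose c hc hW hlam using fun k => exists_pos_scaling_mem_Icc (W k) (lam k)
  exact ⟨fun k => c k • W k, fun k => c k * lam k, hW, hlam,
    fun x => bdnn_smul d W lam c hc x K⟩
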